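/- arXiv:2406.10182 — 2 statements merged into one kernel-verified Lean document; each statement's English description precedes it below -/
import Mathlib

section
/- Let (L,¬) be a fundamental lattice with ⊥ ≠ ⊤ and let (X,R) = Ϝ(L) be its canonical frame. For all points x = (x_F, x_I) and y = (y_F, y_I) of X: x ≤⁺_R y if and only if y_F ⊆ x_F, and x ≤⁻_R y if and only if y_I ⊆ x_I. -/
def negR {X : Type*} (R : X → X → Prop) (A : Set X) : Set X := {x | ∀ x', R x' x → x' ∉ A}

def nnegR {X : Type*} (R : X → X → Prop) (A : Set X) : Set X := {x | ∀ x', R x x' → x' ∉ A}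

def CR {X : Type*} (R : X → X → Prop) (A : Set X) : Set X :=
  {x | ∀ y, R y x → ∃ z, R y z ∧ z ∈ A}

def posAlg {X : Type*} (R : X → X → Prop) : Set (Set X) := {A | CR R A = A}

def negAlg {X : Type*} (R : X → X → Prop) : Set (Set X) := {A | ∃ B, A = nnegR R B}

def plePos {X : Type*} (R : X → X → Prop) (x x' : X) : Prop := ∀ z, R z x → R z x'

def nleNeg {X : Type*} (R : X → X → Prop) (x x' : X) : Prop := ∀ z, R x z → R x' z

def CoSerial {X : Type*} (R : X → X → Prop) : Prop := ∀ x, ∃ x', R x' x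

def PseudoRefl {X : Type*} (R : X → X → Prop) : Prop := ∀ x, ∃ y, R y x ∧ plePos R y x

def PseudoSym {X : Type*} (R : X → X → Prop) : Prop :=
  ∀ x x', R x x' → ∃ y, R y x ∧ plePos R y x'

def IsFundFrame {X : Type*} (R : X → X → Prop) : Prop :=
  CoSerial R ∧ PseudoRefl R ∧ PseudoSym R

def IsProperFilter {L : Type*} [Lattice L] [BoundedOrder L] (F : Set L) : Prop :=
  ⊤ ∈ F ∧ ⊥ ∉ F ∧ (∀ a b, a ∈ F → a ≤ b → b ∈ F) ∧ (∀ a b, a ∈ F → b ∈ F → a ⊓ b ∈ F)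

def IsProperIdeal {L : Type*} [Lattice L] [BoundedOrder L] (I : Set L) : Prop :=
  ⊥ ∈ I ∧ ⊤ ∉ I ∧ (∀ a b, a ∈ I → b ≤ a → b ∈ I) ∧ (∀ a b, a ∈ I → b ∈ I → a ⊔ b ∈ I)

def IsFundLattice {L : Type*} [Lattice L] [BoundedOrder L] (neg : L → L) : Prop :=
  (∀ a b, a ≤ neg b ↔ b ≤ neg a) ∧ (∀ a, a ⊓ neg a = ⊥)

structure CanPoint (L : Type*) [Lattice L] [BoundedOrder L] (neg : L → L) where
  F : Set L
  I : Set L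
  hF : IsProperFilter F
  hI : IsProperIdeal I
  compat : ∀ a ∈ F, neg a ∈ I

def canRel {L : Type*} [Lattice L] [BoundedOrder L] {neg : L → L}
    (x y : CanPoint L neg) : Prop := x.I ∩ y.F = ∅

def hat {L : Type*} [Lattice L] [BoundedOrder L] (neg : L → L) (a : L) :
    Set (CanPoint L neg) := {x | a ∈ x.F}

theorem IsFundLattice.antitone {L : Type*} [Lattice L] [BoundedOrder L] {neg : L → L}
    (hL : IsFundLattice neg) : Antitone neg := fun a b hab =>
  (hL.1 a (neg b)).1 (hab.trans ((hL.1 (neg b) b).1 le_rfl))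

theorem IsFundLattice.neg_top {L : Type*} [Lattice L] [BoundedOrder L] {neg : L → L}
    (hL : IsFundLattice neg) : neg ⊤ = ⊥ := by
  simpa using hL.2 ⊤

theorem IsFundLattice.neg_ne_top {L : Type*} [Lattice L] [BoundedOrder L] {neg : L → L}
    (hL : IsFundLattice neg) {a : L} (ha : a ≠ ⊥) : neg a ≠ ⊤ := fun h =>
  ha (by simpa [h] using hL.2 a)

theorem isProperFilter_Ici {L : Type*} [Lattice L] [BoundedOrder L] {a : L} (ha : a ≠ ⊥) :
    IsProperFilter (Set.Ici a) :=
  ⟨le_top, fun h => ha (le_bot_iff.1 h), fun _ _ h hle => le_trans h hle,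
    fun _ _ hb hc => le_inf hb hc⟩

theorem isProperIdeal_Iic {L : Type*} [Lattice L] [BoundedOrder L] {a : L} (ha : a ≠ ⊤) :
    IsProperIdeal (Set.Iic a) :=
  ⟨bot_le, fun h => ha (top_le_iff.1 h), fun _ _ h hle => le_trans hle h,
    fun _ _ hb hc => sup_le hb hc⟩

/-- The point of the canonical frame given by a principal filter and a principal ideal. -/
def CanPoint.principal {L : Type*} [Lattice L] [BoundedOrder L] {neg : L → L}
    (hL : IsFundLattice neg) {a b : L} (ha : a ≠ ⊥) (hb : b ≠ ⊤) (hab : neg a ≤ b) :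
    CanPoint L neg where
  F := Set.Ici a
  I := Set.Iic b
  hF := isProperFilter_Ici ha
  hI := isProperIdeal_Iic hb
  compat _ hc := (hL.antitone hc).trans hab

theorem canRel_iff {L : Type*} [Lattice L] [BoundedOrder L] {neg : L → L}
    {x y : CanPoint L neg} : canRel x y ↔ ∀ a ∈ x.I, a ∉ y.F := by
  simp [canRel, Set.eq_empty_iff_forall_notMem]

theorem stmt6 {L : Type*} [Lattice L] [BoundedOrder L] (neg : L → L)
    (hL : IsFundLattice neg) (hbt : (⊥ : L) ≠ ⊤)
    (x y : CanPoint L neg) :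
    (plePos (@canRel L _ _ neg) x y ↔ y.F ⊆ x.F) ∧
    (nleNeg (@canRel L _ _ neg) x y ↔ y.I ⊆ x.I) := by
  simp only [plePos, nleNeg, canRel_iff]
  refine ⟨⟨fun h a hay => ?_, fun h z hz a ha hay => hz a ha (h hay)⟩,
    ⟨fun h a hay => ?_, fun h z hz a ha => hz a (h ha)⟩⟩
  · by_contra hax
    have ha : a ≠ ⊤ := fun e => hax (e ▸ x.hF.1)
    exact h (.principal hL hbt.symm ha (hL.neg_top.trans_le bot_le))
      (fun b hb hbx => hax (x.hF.2.2.1 b a hbx hb)) a (le_refl a) hay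
  · by_contra hax
    have ha : a ≠ ⊥ := fun e => hax (e ▸ x.hI.1)
    exact h (.principal hL ha (hL.neg_ne_top ha) le_rfl)
      (fun b hbx hb => hax (x.hI.2.2.1 b a hbx hb)) a hay (le_refl a)
end

section
/- Let h : (X,R) → (Y,S) be an f-morphism between fundamental frames. The map χ(h) : χ⁺_S(Y) → χ⁺_R(X) given by A ↦ h⁻¹[A] is injective if and only if h is dense. -/
def IsFMorphism {X Y : Type*} (R : X → X → Prop) (S : Y → Y → Prop) (h : X → Y) : Prop :=
  (∀ x x', R x x' → S (h x) (h x')) ∧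
  (∀ x y, S (h x) y → ∃ x', R x x' ∧ plePos S (h x') y) ∧
  (∀ x y, S y (h x) → ∃ x', R x' x ∧ nleNeg S (h x') y) ∧
  (∀ x y, S y (h x) → ∃ x'', R x'' x ∧ plePos S (h x'') y)

theorem subset_CR {X : Type*} (R : X → X → Prop) (A : Set X) : A ⊆ CR R A :=
  fun x hx _ hy => ⟨x, hy, hx⟩

theorem CR_mono {X : Type*} (R : X → X → Prop) {A B : Set X} (hAB : A ⊆ B) :
    CR R A ⊆ CR R B := by
  intro x hx y hy
  obtain ⟨z, hyz, hz⟩ := hx y hy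
  exact ⟨z, hyz, hAB hz⟩

theorem CR_mem_posAlg {X : Type*} (R : X → X → Prop) (A : Set X) : CR R A ∈ posAlg R := by
  refine Set.Subset.antisymm ?_ (subset_CR R _)
  intro x hx y hy
  obtain ⟨z, hyz, hz⟩ := hx y hy
  exact hz y hyz

theorem mem_CR_singleton {X : Type*} (R : X → X → Prop) (x y : X) :
    x ∈ CR R {y} ↔ plePos R x y := by
  simp [CR, plePos]

theorem mem_of_plePos {X : Type*} {R : X → X → Prop} {A : Set X} (hA : A ∈ posAlg R)
    {x y : X} (hxy : plePos R x y) (hy : y ∈ A) : x ∈ A := by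
  have hCR : CR R A = A := hA
  rw [← hCR]
  exact fun z hz => ⟨y, hxy z hz, hy⟩

/-- Density transfers inclusions between preimages back to the fixpoints themselves. -/
theorem subset_of_preimage_subset {X Y : Type*} {S : Y → Y → Prop} {h : X → Y}
    (hd : ∀ y y' : Y, S y' y → ∃ x : X, plePos S (h x) y ∧ S y' (h x))
    {A B : Set Y} (hA : A ∈ posAlg S) (hB : B ∈ posAlg S) (hAB : h ⁻¹' A ⊆ h ⁻¹' B) :
    A ⊆ B := by
  intro y hy
  have hCR : CR S B = B := hB
  rw [← hCR]
  intro y' hy'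
  obtain ⟨x, hxy, hx⟩ := hd y y' hy'
  exact ⟨h x, hx, hAB (mem_of_plePos hA hxy hy)⟩

theorem stmt7 {X Y : Type*} (R : X → X → Prop) (S : Y → Y → Prop)
    (hR : IsFundFrame R) (hS : IsFundFrame S)
    (h : X → Y) (hh : IsFMorphism R S h) :
    (∀ A ∈ posAlg S, ∀ B ∈ posAlg S, h ⁻¹' A = h ⁻¹' B → A = B) ↔
    (∀ y y' : Y, S y' y → ∃ x : X, plePos S (h x) y ∧ S y' (h x)) := by
  constructor
  · intro hinj y y' hy'
    set A := CR S {y}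
    have hsub : CR S (h '' (h ⁻¹' A)) ⊆ A := by
      have hfix : CR S A = A := CR_mem_posAlg S {y}
      exact (CR_mono S (Set.image_preimage_subset h A)).trans hfix.subset
    have hpre : h ⁻¹' A = h ⁻¹' CR S (h '' (h ⁻¹' A)) :=
      Set.Subset.antisymm (fun x hx => subset_CR S _ (Set.mem_image_of_mem h hx))
        (Set.preimage_mono hsub)
    have hEq := hinj A (CR_mem_posAlg S _) _ (CR_mem_posAlg S _) hpre
    have hy : y ∈ CR S (h '' (h ⁻¹' A)) := hEq ▸ subset_CR S {y} rfl
    obtain ⟨_, hxy', x, hx, rfl⟩ := hy y' hy'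
    exact ⟨x, (mem_CR_singleton S _ _).1 hx, hxy'⟩
  · intro hd A hA B hB hAB
    exact Set.Subset.antisymm (subset_of_preimage_subset hd hA hB hAB.subset)
      (subset_of_preimage_subset hd hB hA hAB.symm.subset)
end
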